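/- arXiv:2012.01500 — 2 statements merged into one kernel-verified Lean document; each statement's English description precedes it below -/
import Mathlib

section
/- Let R be an infinite commutative domain with field of fractions K, and let A be a semiprime associative unital R-algebra whose group of units U(A) satisfies a Laurent polynomial identity P (with nonzero coefficient of the identity word and every non-identity word in the support of P having nonzero sum of exponents in at least one variable). Then every idempotent element of the ring of fractions R^{-1}A (realized as the base change K ⊗_R A, i.e. FractionRing R ⊗[R] A) is central. -/
/-- The sum of exponents of the word `w` in the `i`-th variable (the `i`-th coordinate of
the image of `w` in the abelianization of the free group). -/
def expSum {l : ℕ} (i : Fin l) (w : FreeGroup (Fin l)) : ℤ :=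
  Multiplicative.toAdd
    (FreeGroup.lift (fun j => Multiplicative.ofAdd (if j = i then (1 : ℤ) else 0)) w)

/-- Evaluation of an element of the group algebra `R[F_l]` of the free group on the
units of an `R`-algebra `A`, induced by an assignment of the variables to units. -/
noncomputable def lpiEval {R : Type*} [CommRing R] {A : Type*} [Ring A] [Algebra R A]
    {l : ℕ} (u : Fin l → Aˣ) : MonoidAlgebra R (FreeGroup (Fin l)) →ₐ[R] A :=
  MonoidAlgebra.lift R A (FreeGroup (Fin l)) ((Units.coeHom A).comp (FreeGroup.lift u))

/-- The group of units of `A` satisfies the Laurent polynomial identity `P`. -/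
def SatisfiesLPI {R : Type*} [CommRing R] (A : Type*) [Ring A] [Algebra R A]
    {l : ℕ} (P : MonoidAlgebra R (FreeGroup (Fin l))) : Prop :=
  ∀ u : Fin l → Aˣ, lpiEval u P = 0

/-- A Laurent polynomial with nonzero coefficient of the identity word such that every
non-identity word in its support has nonzero sum of exponents in at least one variable. -/
def GoodLPI {R : Type*} [CommRing R] {l : ℕ}
    (P : MonoidAlgebra R (FreeGroup (Fin l))) : Prop :=
  P.coeff 1 ≠ 0 ∧ ∀ w ∈ P.coeff.support, w ≠ 1 → ∃ i : Fin l, expSum i w ≠ 0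


open scoped TensorProduct

/-- A ring `A` is semiprime if every two-sided ideal `I` with `I² = 0` is zero. -/
def IsSemiprimeRing (A : Type*) [Ring A] : Prop :=
  ∀ I : TwoSidedIdeal A, (∀ x ∈ I, ∀ y ∈ I, x * y = 0) → I = ⊥

/-- Elementwise form of semiprimeness. -/
theorem semiprime_elt {A : Type*} [Ring A] (hA : IsSemiprimeRing A) (z : A)
    (h : ∀ y, z * y * z = 0) : z = 0 := by
  have h1 : ∀ x ∈ TwoSidedIdeal.span {z}, ∀ t, z * t * x = 0 := by
    intro x hx
    induction hx using TwoSidedIdeal.span_induction with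
    | mem x hx => intro t; rw [Set.mem_singleton_iff.1 hx]; exact h t
    | zero => simp
    | add x y _ _ hx hy => intro t; rw [mul_add, hx, hy, add_zero]
    | neg x _ hx => intro t; rw [mul_neg, hx, neg_zero]
    | left_absorb a x _ hx => intro t; rw [← mul_assoc, mul_assoc z t a, hx]
    | right_absorb b x _ hx => intro t; rw [← mul_assoc, hx, zero_mul]
  have h2 : ∀ x ∈ TwoSidedIdeal.span {z}, ∀ y ∈ TwoSidedIdeal.span {z}, ∀ t, x * t * y = 0 := by
    intro x hx
    induction hx using TwoSidedIdeal.span_induction with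
    | mem x hx => intro y hy t; rw [Set.mem_singleton_iff.1 hx]; exact h1 y hy t
    | zero => simp
    | add x y _ _ hx hy => intro w hw t; rw [add_mul, add_mul, hx w hw, hy w hw, add_zero]
    | neg x _ hx => intro w hw t; rw [neg_mul, neg_mul, hx w hw, neg_zero]
    | left_absorb a x _ hx =>
      intro w hw t; rw [mul_assoc a, mul_assoc a, hx w hw, mul_zero]
    | right_absorb b x _ hx =>
      intro w hw t; rw [mul_assoc x b t, hx w hw]
  have h3 := hA (TwoSidedIdeal.span {z}) (fun x hx y hy => by simpa using h2 x hx y hy 1)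
  have h4 : z ∈ TwoSidedIdeal.span {z} := TwoSidedIdeal.subset_span rfl
  rw [h3] at h4
  simpa using h4

/-- Levitzki's lemma, elementwise form. -/
theorem levitzki {A : Type*} [Ring A] (hA : IsSemiprimeRing A) (n : ℕ) :
    ∀ z : A, (∀ y, (z * y) ^ n * z = 0) → z = 0 := by
  induction n with
  | zero => intro z h; simpa using h 0
  | succ n ih =>
    intro z h
    rcases Nat.eq_zero_or_pos n with rfl | hn
    · exact semiprime_elt hA z (by simpa using h)
    have key : ∀ y, (z * y) * (z * y) * z = 0 → z * y * z = 0 := by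
      intro y hy
      apply ih
      intro r
      set x := z * y with hx
      have hs : ∀ k, (x * (1 + z * r)) ^ k * (x * z) = (x * z * r) ^ k * (x * z) := by
        intro k
        induction k with
        | zero => simp
        | succ k ihk =>
          have e1 : x * (1 + z * r) * (x * z) = x * z * (r * (x * z)) := by
            have : x * (1 + z * r) * (x * z) = x * x * z + x * z * (r * (x * z)) := by noncomm_ring
            rw [this, hy, zero_add]
          rw [pow_succ, mul_assoc, e1, ← mul_assoc _ (x * z), ihk, pow_succ]
          simp only [mul_assoc]
      have h1 := h (y * (1 + z * r))
      rw [← mul_assoc z, ← hx] at h1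
      have h2 : (x * (1 + z * r)) ^ (n + 1) * z
          = (x * (1 + z * r)) ^ n * (x * z) + (x * (1 + z * r)) ^ n * (x * z) * (r * z) := by
        rw [pow_succ]; noncomm_ring
      rw [h2, hs] at h1
      have h3 : (x * z * r) ^ n * (x * z) * (r * z) = (z * (y * z * r)) ^ (n + 1) * z := by
        rw [pow_succ, hx]; simp only [mul_assoc]
      rw [h3, h, add_zero] at h1
      exact h1
    apply ih
    intro y
    obtain ⟨m, rfl⟩ : ∃ m, n = m + 1 := ⟨n - 1, by omega⟩
    have e : z * (y * (z * y) ^ m) = (z * y) ^ (m + 1) := by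
      rw [pow_succ', mul_assoc]
    have := key (y * (z * y) ^ m)
    rw [e] at this
    apply this
    have : (z * y) ^ (m + 1) * (z * y) ^ (m + 1) * z
        = (z * y) ^ m * ((z * y) ^ (m + 1 + 1) * z) := by
      rw [← mul_assoc, ← pow_add, ← pow_add]; congr 2; ring
    rw [this, h, mul_zero]

/-- Vandermonde argument. -/
theorem vander {R : Type*} [CommRing R] [IsDomain R] [Infinite R] (d : ℕ) :
    ∃ V : R, V ≠ 0 ∧ ∀ (A : Type*) [AddCommGroup A] [Module R A] (c : ℕ → A),
      (∀ r : R, ∑ j ∈ Finset.range (d + 1), r ^ j • c j = 0) → V • c d = 0 := by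
  let v : Fin (d + 1) → R := fun i => Infinite.natEmbedding R i
  have hv : Function.Injective v := fun i j h => Fin.ext ((Infinite.natEmbedding R).injective h)
  let M := Matrix.vandermonde v
  refine ⟨M.det, Matrix.det_vandermonde_ne_zero_iff.2 hv, ?_⟩
  intro A _ _ c h
  have h1 : ∀ i : Fin (d + 1), ∑ j : Fin (d + 1), M i j • c j = 0 := by
    intro i
    rw [← h (v i), Finset.sum_range]
    rfl
  have h2 : ∑ i, M.adjugate (Fin.last d) i • ∑ j : Fin (d + 1), M i j • c j = 0 := by
    simp [h1]
  simp_rw [Finset.smul_sum, smul_smul] at h2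
  rw [Finset.sum_comm] at h2
  simp_rw [← Finset.sum_smul, ← Matrix.mul_apply, Matrix.adjugate_mul] at h2
  simpa [Matrix.smul_apply, Matrix.one_apply] using h2

theorem pow_expand {R : Type*} [CommRing R] {A : Type*} [Ring A] [Algebra R A] (v w : A) (k : ℕ) :
    ∃ c : ℕ → A, c k = w ^ k ∧ (∀ j, k < j → c j = 0) ∧
      ∀ r : R, ∀ d, k ≤ d → (v + r • w) ^ k = ∑ j ∈ Finset.range (d + 1), r ^ j • c j := by
  induction k with
  | zero =>
    refine ⟨fun j => if j = 0 then 1 else 0, by simp, fun j hj => by simp; omega, ?_⟩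
    intro r d _
    simp
  | succ k ih =>
    obtain ⟨c, h1, h2, h3⟩ := ih
    refine ⟨fun j => c j * v + (if j = 0 then 0 else c (j - 1) * w), ?_, ?_, ?_⟩
    · simp [h1, h2, pow_succ]
    · intro j hj
      have : j ≠ 0 := by omega
      simp only [this, if_false]
      rw [h2 j (by omega), h2 (j - 1) (by omega)]; simp
    · intro r d hd
      obtain ⟨d, rfl⟩ : ∃ m, d = m + 1 := ⟨d - 1, by omega⟩
      simp only [smul_add, Finset.sum_add_distrib]
      rw [pow_succ, mul_add]
      congr 1
      · rw [h3 r (d + 1) (by omega), Finset.sum_mul]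
        simp only [smul_mul_assoc]
      · rw [Finset.sum_range_succ', h3 r d (by omega), Finset.sum_mul]
        simp [smul_smul, pow_succ, mul_comm r]

/-- From the identity on units to an identity on square-zero elements. -/
theorem sqzero {R : Type*} [CommRing R] [IsDomain R] [Infinite R]
    {A : Type*} [Ring A] [Algebra R A] (f : Polynomial R) (hf : f ≠ 0)
    (h : ∀ u : Aˣ, Polynomial.aeval (u : A) f = 0) :
    ∃ c : R, c ≠ 0 ∧ ∀ a b : A, a * a = 0 → b * b = 0 →
      c • ((a * b) ^ f.natDegree * a) = 0 := by
  obtain ⟨V, hV, hV'⟩ := vander (R := R) f.natDegree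
  refine ⟨V * f.leadingCoeff, mul_ne_zero hV (Polynomial.leadingCoeff_ne_zero.2 hf), ?_⟩
  intro a b ha hb
  have hu : ∀ r : R, Polynomial.aeval ((1 + b) + r • (a * (1 + b))) f = 0 := by
    intro r
    let u1 : Aˣ := ⟨1 + r • a, 1 - r • a, by
      simp [mul_sub, add_mul, ha], by simp [mul_add, sub_mul, ha]⟩
    let u2 : Aˣ := ⟨1 + b, 1 - b, by
      simp [mul_sub, add_mul, hb], by simp [mul_add, sub_mul, hb]⟩
    have := h (u1 * u2)
    have e : ((u1 * u2 : Aˣ) : A) = (1 + b) + r • (a * (1 + b)) := by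
      simp [u1, u2, add_mul]
    rwa [e] at this
  choose c h1 h2 h3 using pow_expand (R := R) (1 + b) (a * (1 + b))
  have h4 := hV' A (fun j => ∑ k ∈ Finset.range (f.natDegree + 1), f.coeff k • c k j) (by
    intro r
    rw [← hu r, Polynomial.aeval_eq_sum_range]
    simp_rw [Finset.smul_sum]
    rw [Finset.sum_comm]
    refine Finset.sum_congr rfl fun k hk => ?_
    rw [h3 k r f.natDegree (by simpa [Nat.lt_succ_iff] using hk), Finset.smul_sum]
    exact Finset.sum_congr rfl fun j _ => smul_comm _ _ _)
  rw [Finset.sum_range_succ, Finset.sum_eq_zero (fun k hk => by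
    rw [h2 k _ (Finset.mem_range.1 hk), smul_zero]), zero_add, h1, smul_smul] at h4
  have h5 : ∀ k, (a * (1 + b)) ^ k * a = (a * b) ^ k * a := by
    intro k
    induction k with
    | zero => simp
    | succ k ih =>
      have : a * (1 + b) * a = a * (b * a) := by
        have : a * (1 + b) * a = a * a + a * (b * a) := by noncomm_ring
        rw [this, ha, zero_add]
      rw [pow_succ, mul_assoc, this, ← mul_assoc, ih, pow_succ]
      simp only [mul_assoc]
  rw [← h5, ← smul_mul_assoc]
  unfold Polynomial.leadingCoeff
  rw [h4, zero_mul]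

theorem mid {R : Type*} [CommRing R]
    {A : Type*} [Ring A] [Algebra R A] (hA : IsSemiprimeRing A) (c : R) (d : ℕ)
    (h : ∀ a b : A, a * a = 0 → b * b = 0 → c • ((a * b) ^ d * a) = 0)
    (r : R) (a b : A) (hab : a * b = 0) (hba : b * a = 0) (hs : a + b = r • 1) (x : A) :
    (c * r ^ 2) • (a * x * b) = 0 := by
  have ha : a * a = r • a := by
    have : a * (a + b) = r • a := by rw [hs]; simp
    rwa [mul_add, hab, add_zero] at this
  have hb : b * b = r • b := by
    have : b * (a + b) = r • b := by rw [hs]; simp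
    rwa [mul_add, hba, zero_add] at this
  set z := a * x * b with hz
  have haz : a * z = r • z := by rw [hz, mul_assoc, ← mul_assoc, ha, smul_mul_assoc]
  have hzb : z * b = r • z := by rw [hz, mul_assoc, hb, mul_smul_comm]
  have hzz : z * z = 0 := by
    have : z * z = a * x * (b * a) * x * b := by rw [hz]; simp only [mul_assoc]
    rw [this, hba]; simp
  have key : ∀ y, (c * r ^ (2 * d)) • ((z * y) ^ d * z) = 0 := by
    intro y
    have hw : (b * y * a) * (b * y * a) = 0 := by
      have : (b * y * a) * (b * y * a) = b * y * (a * b) * y * a := by simp only [mul_assoc]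
      rw [this, hab]; simp
    have h1 := h z (b * y * a) hzz hw
    have h2 : ∀ k, (z * (b * y * a)) ^ k * z = r ^ (2 * k) • ((z * y) ^ k * z) := by
      intro k
      induction k with
      | zero => simp
      | succ k ih =>
        have e : z * (b * y * a) * z = r ^ 2 • (z * (y * z)) := by
          have : z * (b * y * a) * z = z * b * y * (a * z) := by simp only [mul_assoc]
          rw [this, haz, hzb]
          simp [smul_smul, pow_two, mul_assoc]
        rw [pow_succ, mul_assoc, e, mul_smul_comm, ← mul_assoc, ih, smul_mul_assoc, smul_smul,
          pow_succ (z * y)]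
        simp only [mul_assoc]
        congr 1
        ring
    rw [h2, smul_smul] at h1
    exact h1
  apply levitzki hA d
  intro y
  have : ((c * r ^ 2) • z * y) ^ d * ((c * r ^ 2) • z)
      = (c ^ d * r ^ 2) • ((c * r ^ (2 * d)) • ((z * y) ^ d * z)) := by
    rw [smul_mul_assoc, smul_pow, smul_mul_smul_comm, smul_smul]
    congr 1
    ring
  rw [this, key, smul_zero]

/-- Specialization of the Laurent identity to one variable. -/
theorem onevar {R : Type*} [CommRing R] {A : Type*} [Ring A] [Algebra R A]
    {l : ℕ} (P : MonoidAlgebra R (FreeGroup (Fin l)))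
    (hP : GoodLPI P) (hLPI : SatisfiesLPI A P) :
    ∃ f : Polynomial R, f ≠ 0 ∧ ∀ u : Aˣ, Polynomial.aeval (u : A) f = 0 := by
  classical
  obtain ⟨hP1, hP2⟩ := hP
  -- choose exponents
  obtain ⟨n, hn⟩ : ∃ n : Fin l → ℤ, ∀ w ∈ P.coeff.support, w ≠ 1 →
      ∑ i, expSum i w * n i ≠ 0 := by
    let Q : MvPolynomial (Fin l) ℤ := ∏ w ∈ P.coeff.support.erase 1,
      ∑ i, MvPolynomial.C (expSum i w) * MvPolynomial.X i
    have hQ : Q ≠ 0 := by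
      refine Finset.prod_ne_zero_iff.2 fun w hw h0 => ?_
      obtain ⟨i, hi⟩ := hP2 w (Finset.mem_of_mem_erase hw) (Finset.ne_of_mem_erase hw)
      apply hi
      have := congrArg (MvPolynomial.eval (Pi.single i 1)) h0
      simpa [Pi.single_apply] using this
    by_contra! hcon
    apply hQ
    refine MvPolynomial.funext fun n => ?_
    obtain ⟨w, hw, hw1, h0⟩ := hcon n
    rw [map_zero, map_prod]
    refine Finset.prod_eq_zero (Finset.mem_erase.2 ⟨hw1, hw⟩) ?_
    simpa using h0
  let φ : FreeGroup (Fin l) → ℤ := fun w => ∑ i, expSum i w * n i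
  have hφ1 : φ 1 = 0 := by simp [φ, expSum]
  have hφ : ∀ (u : Aˣ) w, FreeGroup.lift (fun i => u ^ n i) w = u ^ φ w := by
    intro u w
    let ψ : FreeGroup (Fin l) →* Aˣ :=
      { toFun := fun w => u ^ φ w
        map_one' := by rw [hφ1, zpow_zero]
        map_mul' := by
          intro x y
          rw [← zpow_add]
          congr 1
          simp [φ, expSum, add_mul, Finset.sum_add_distrib] }
    have : FreeGroup.lift (fun i => u ^ n i) = ψ := by
      ext i
      simp [ψ, φ, expSum]
    rw [this]; rfl
  obtain ⟨N, hN⟩ : ∃ N : ℕ, ∀ w ∈ P.coeff.support, 0 ≤ φ w + N := by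
    refine ⟨∑ w ∈ P.coeff.support, (φ w).natAbs, fun w hw => ?_⟩
    have := Finset.single_le_sum (f := fun w => (φ w).natAbs) (fun _ _ => Nat.zero_le _) hw
    omega
  refine ⟨∑ w ∈ P.coeff.support, Polynomial.monomial (φ w + N).toNat (P.coeff w), ?_, ?_⟩
  · intro h0
    have := congrArg (fun f => Polynomial.coeff f N) h0
    simp only [Polynomial.finsetSum_coeff, Polynomial.coeff_monomial, Polynomial.coeff_zero] at this
    rw [Finset.sum_eq_single 1] at this
    · rw [hφ1] at this
      simp at this
      exact hP1 this
    · intro w hw hw1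
      rw [if_neg]
      have h1 := hn w hw hw1
      have h2 := hN w hw
      change φ w ≠ 0 at h1
      omega
    · intro h
      simp at h
      exact absurd h hP1
  · intro u
    have h1 := hLPI (fun i => u ^ n i)
    rw [lpiEval, MonoidAlgebra.lift_apply] at h1
    have h2 : (u : A) ^ N * (P.coeff.sum fun a b => b •
      ((Units.coeHom A).comp (FreeGroup.lift fun i => u ^ n i)) a) = 0 := by
      rw [← mul_zero ((u : A) ^ N)]; exact congrArg _ h1
    rw [map_sum, ← h2, Finsupp.sum, Finset.mul_sum]
    refine Finset.sum_congr rfl fun w hw => ?_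
    rw [Polynomial.aeval_monomial, mul_smul_comm, Algebra.smul_def]
    congr 1
    simp only [MonoidHom.comp_apply, Units.coeHom_apply, hφ]
    rw [← Units.val_pow_eq_pow_val, ← Units.val_pow_eq_pow_val, ← Units.val_mul]
    congr 1
    rw [← zpow_natCast, ← zpow_natCast, ← zpow_add, Int.toNat_of_nonneg (hN w hw), add_comm]

/-- Let `R` be an infinite commutative domain with field of fractions `K`,
and `A` a semiprime `R`-algebra whose unit group satisfies a Laurent polynomial identity
`P` as above. Then every idempotent element of the ring of fractions
`R⁻¹A = K ⊗[R] A` is central. -/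
theorem stmt5 {R : Type*} [CommRing R] [IsDomain R] [Infinite R]
    {A : Type*} [Ring A] [Algebra R A] (hA : IsSemiprimeRing A)
    {l : ℕ} (P : MonoidAlgebra R (FreeGroup (Fin l)))
    (hP : GoodLPI P) (hLPI : SatisfiesLPI A P) :
    ∀ e : FractionRing R ⊗[R] A, e * e = e →
      ∀ x : FractionRing R ⊗[R] A, e * x = x * e := by
  intro e he x
  obtain ⟨f, hf, hfu⟩ := onevar P hP hLPI
  obtain ⟨c, hc, hsq⟩ := sqzero f hf hfu
  let ι : A →ₗ[R] FractionRing R ⊗[R] A := TensorProduct.mk R (FractionRing R) A 1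
  have hι : ∀ a b, ι a * ι b = ι (a * b) := fun a b => by simp [ι]
  have : IsLocalizedModule (nonZeroDivisors R) ι :=
    (isLocalizedModule_iff_isBaseChange (nonZeroDivisors R) (FractionRing R) ι).2
      (TensorProduct.isBaseChange R A (FractionRing R))
  have cancel : ∀ (r : R), r ≠ 0 → ∀ s t : FractionRing R ⊗[R] A, r • s = r • t → s = t := by
    intro r hr s t h
    exact IsLocalizedModule.smul_injective ι ⟨r, mem_nonZeroDivisors_of_ne_zero hr⟩ h
  obtain ⟨⟨a₀, r₀⟩, h₀⟩ := IsLocalizedModule.surj (nonZeroDivisors R) ι e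
  obtain ⟨⟨x₀, t₀⟩, hx₀⟩ := IsLocalizedModule.surj (nonZeroDivisors R) ι x
  replace h₀ : (r₀ : R) • e = ι a₀ := h₀
  replace hx₀ : (t₀ : R) • x = ι x₀ := hx₀
  have h1 : ι (a₀ * a₀) = ι ((r₀ : R) • a₀) := by
    rw [← hι, map_smul, ← h₀, smul_mul_smul_comm, he, smul_smul]
  obtain ⟨s, hs⟩ := IsLocalizedModule.exists_of_eq (S := nonZeroDivisors R) h1
  replace hs : (s : R) • (a₀ * a₀) = (s : R) • ((r₀ : R) • a₀) := hs
  have hs0 : (s : R) ≠ 0 := nonZeroDivisors.ne_zero s.2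
  have hr0 : (r₀ : R) ≠ 0 := nonZeroDivisors.ne_zero r₀.2
  have ht0 : (t₀ : R) ≠ 0 := nonZeroDivisors.ne_zero t₀.2
  set a : A := (s : R) • a₀ with ha
  set r : R := s * r₀ with hr
  have hrne : r ≠ 0 := mul_ne_zero hs0 hr0
  have haa : a * a = r • a := by
    rw [ha, smul_mul_smul_comm, mul_smul, hs, smul_smul, smul_smul, smul_smul, hr]
    congr 1; ring
  have hre : r • e = ι a := by rw [hr, mul_smul, h₀, ha, map_smul]
  have hab : a * (r • 1 - a) = 0 := by rw [mul_sub, haa]; simp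
  have hba : (r • 1 - a) * a = 0 := by rw [sub_mul, haa]; simp
  have m1 := mid hA c f.natDegree hsq r a (r • 1 - a) hab hba (by abel) x₀
  have m2 := mid hA c f.natDegree hsq r (r • 1 - a) a hba hab (by abel) x₀
  have m3 : (c * r ^ 2 * r) • (a * x₀) = (c * r ^ 2 * r) • (x₀ * a) := by
    have e1 : a * x₀ * (r • 1 - a) = r • (a * x₀) - a * x₀ * a := by
      rw [mul_sub]; simp
    have e2 : (r • 1 - a) * x₀ * a = r • (x₀ * a) - a * x₀ * a := by
      rw [sub_mul, sub_mul]; simp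
    rw [e1, smul_sub, sub_eq_zero] at m1
    rw [e2, smul_sub, sub_eq_zero] at m2
    rw [mul_smul (c * r ^ 2), mul_smul (c * r ^ 2), m1, m2]
  have m4 : ι (a * x₀) = ι (x₀ * a) := by
    apply cancel (c * r ^ 2 * r) (mul_ne_zero (mul_ne_zero hc (pow_ne_zero _ hrne)) hrne)
    rw [← map_smul, ← map_smul, m3]
  apply cancel (r * t₀) (mul_ne_zero hrne ht0)
  rw [← smul_mul_smul_comm, hre, hx₀, hι, m4, ← hι, ← hre, ← hx₀, smul_mul_smul_comm, mul_comm r]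
end

section
/- Let G be a torsion group and R a commutative domain of characteristic 0. If the group of units U(RG) of the group algebra RG satisfies a Laurent polynomial identity P (with nonzero coefficient of the identity word and every non-identity word in the support of P having nonzero sum of exponents in at least one variable), then RG satisfies the standard identity S_4 of degree four: for all y_1, y_2, y_3, y_4 in RG, the sum over all permutations σ of {1,2,3,4} of sgn(σ)·y_{σ(1)}·y_{σ(2)}·y_{σ(3)}·y_{σ(4)} equals 0. -/
theorem s4_perm_sum {M : Type*} [AddCommMonoid M] {n : ℕ} (f : Equiv.Perm (Fin (n+1)) → M) :
    ∑ σ, f σ = ∑ p : Fin (n+1), ∑ e : Equiv.Perm (Fin n), f (Equiv.Perm.decomposeFin.symm (p, e)) := by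
  rw [← Equiv.sum_comp Equiv.Perm.decomposeFin.symm, Fintype.sum_prod_type]

theorem s4_one {A : Type*} [Ring A] (v : Fin 4 → A) (h : v 0 = 1) :
    ∑ σ : Equiv.Perm (Fin 4),
        (Equiv.Perm.sign σ : ℤ) • (v (σ 0) * v (σ 1) * v (σ 2) * v (σ 3)) = 0 := by
  have e1 : (1 : Fin 4) = Fin.succ 0 := rfl
  have e2 : (2 : Fin 4) = Fin.succ (Fin.succ 0) := rfl
  have e3 : (3 : Fin 4) = Fin.succ (Fin.succ (Fin.succ 0)) := rfl
  simp only [s4_perm_sum, Equiv.Perm.decomposeFin.symm_sign, Fin.sum_univ_succ, Fin.sum_univ_zero,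
    Finset.univ_unique, Finset.sum_singleton]
  simp only [e1, e2, e3, Equiv.Perm.decomposeFin_symm_apply_succ,
    Equiv.Perm.decomposeFin_symm_apply_zero]
  simp [Equiv.swap_apply_def, Fin.ext_iff, h]
  noncomm_ring

theorem s4_of_span {R : Type*} [CommRing R] {A : Type*} [Ring A] [Algebra R A]
    (w : Fin 4 → A) (hw : w 0 = 1)
    (hspan : Submodule.span (Subalgebra.center R A) (Set.range w) = ⊤) (v : Fin 4 → A) :
    ∑ σ : Equiv.Perm (Fin 4),
        (Equiv.Perm.sign σ : ℤ) • (v (σ 0) * v (σ 1) * v (σ 2) * v (σ 3)) = 0 := by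
  letI : Algebra (Subalgebra.center R A) A := Algebra.ofModule
    (fun r x y => by simp [Subalgebra.smul_def, mul_assoc])
    (fun r x y => by
      have := Subalgebra.mem_center_iff.1 r.2
      simp only [Subalgebra.smul_def, smul_eq_mul, ← mul_assoc, this])
  let T := MultilinearMap.alternatization
    (MultilinearMap.mkPiAlgebraFin (Subalgebra.center R A) 4 A)
  have hT : ∀ v : Fin 4 → A, T v = ∑ σ : Equiv.Perm (Fin 4),
        (Equiv.Perm.sign σ : ℤ) • (v (σ 0) * v (σ 1) * v (σ 2) * v (σ 3)) := by
    intro v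
    simp only [T, MultilinearMap.alternatization_apply, MultilinearMap.domDomCongr_apply,
      MultilinearMap.mkPiAlgebraFin_apply]
    refine Finset.sum_congr rfl fun σ _ => ?_
    simp [List.ofFn_succ, mul_assoc, Units.smul_def]
  rw [← hT]
  have : T.toMultilinearMap = 0 := by
    refine MultilinearMap.ext_of_span_eq_top (g := fun _ => w) (fun _ => hspan) fun j => ?_
    simp only [zero_apply, AlternatingMap.coe_multilinearMap]
    by_cases hj : Function.Injective j
    · have hb : Function.Bijective j := Finite.injective_iff_bijective.1 hj
      let e : Equiv.Perm (Fin 4) := Equiv.ofBijective j hb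
      have : (fun i => w (j i)) = w ∘ e := rfl
      rw [this, AlternatingMap.map_perm, hT, s4_one w hw, smul_zero]
    · simp only [Function.Injective, not_forall] at hj
      obtain ⟨a, b, hab, hne⟩ := hj
      exact T.map_eq_zero_of_eq _ (by simp [hab]) hne
  exact congrArg (fun f => f v) this

theorem s4_group {R : Type*} [CommRing R] {G : Type*} [Group G] (x y : G)
    (h : ∀ g : G, ∃ t ∈ Subgroup.center G, g = t ∨ g = t * x ∨ g = t * y ∨ g = t * (x * y))
    (v : Fin 4 → MonoidAlgebra R G) :
    ∑ σ : Equiv.Perm (Fin 4),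
        (Equiv.Perm.sign σ : ℤ) • (v (σ 0) * v (σ 1) * v (σ 2) * v (σ 3)) = 0 := by
  refine s4_of_span (R := R) ![1, MonoidAlgebra.of R G x, MonoidAlgebra.of R G y,
    MonoidAlgebra.of R G (x * y)] rfl ?_ v
  rw [eq_top_iff]
  rintro f -
  induction f using MonoidAlgebra.induction_linear with
  | zero => exact zero_mem _
  | add f g hf hg => exact add_mem hf hg
  | single g r =>
    obtain ⟨t, ht, hg⟩ := h g
    have htc : MonoidAlgebra.single t r ∈ Subalgebra.center R (MonoidAlgebra R G) := by
      rw [Subalgebra.mem_center_iff]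
      intro b
      exact ((MonoidAlgebra.single_commute (fun m => (Subgroup.mem_center_iff.1 ht m).symm)
        (fun r' => Commute.all _ _)) b).symm
    have key : ∀ i : Fin 4, ∀ k : G, (![1, MonoidAlgebra.of R G x, MonoidAlgebra.of R G y,
        MonoidAlgebra.of R G (x * y)] i) = MonoidAlgebra.of R G k →
        MonoidAlgebra.single (t * k) r ∈ Submodule.span (Subalgebra.center R (MonoidAlgebra R G))
          (Set.range ![1, MonoidAlgebra.of R G x, MonoidAlgebra.of R G y,
            MonoidAlgebra.of R G (x * y)]) := by
      intro i k hk
      have : MonoidAlgebra.single (t * k) r =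
        (⟨_, htc⟩ : Subalgebra.center R (MonoidAlgebra R G)) • MonoidAlgebra.of R G k := by
        rw [Subalgebra.smul_def, smul_eq_mul]
        simp [MonoidAlgebra.single_mul_single]
      rw [this, ← hk]
      exact Submodule.smul_mem _ _ (Submodule.subset_span ⟨i, rfl⟩)
    rcases hg with rfl | rfl | rfl | rfl
    · simpa using key 0 1 (by simp [MonoidAlgebra.one_def])
    · exact key 1 x rfl
    · exact key 2 y rfl
    · exact key 3 _ rfl

open Polynomial in
theorem exists_weights {l : ℕ} (s : Finset (Fin l → ℤ)) (hs : ∀ e ∈ s, e ≠ 0) :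
    ∃ n : Fin l → ℤ, ∀ e ∈ s, ∑ i, n i * e i ≠ 0 := by
  let F : (Fin l → ℤ) → ℤ[X] := fun e => ∑ i : Fin l, C (e i) * X ^ (i : ℕ)
  have hF : ∀ e ∈ s, F e ≠ 0 := by
    intro e he h0
    apply hs e he
    funext i
    have := congrArg (fun p => p.coeff (i : ℕ)) h0
    simpa [F, coeff_X_pow, Fin.val_inj] using this
  have hprod : ∏ e ∈ s, F e ≠ 0 := Finset.prod_ne_zero_iff.2 hF
  obtain ⟨M, hM⟩ : ∃ M : ℤ, (∏ e ∈ s, F e).eval M ≠ 0 := by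
    by_contra hcon
    push Not at hcon
    exact hprod (Polynomial.funext (by simpa using hcon))
  rw [eval_prod, Finset.prod_ne_zero_iff] at hM
  refine ⟨fun i => M ^ (i : ℕ), fun e he => ?_⟩
  have := hM e he
  simpa [F, eval_finsetSum, mul_comm] using this

open Polynomial in
theorem exists_poly {R : Type*} [CommRing R] {A : Type*} [Ring A] [Algebra R A]
    {l : ℕ} (P : MonoidAlgebra R (FreeGroup (Fin l)))
    (hP : GoodLPI P) (hLPI : SatisfiesLPI A P) :
    ∃ q : R[X], q ≠ 0 ∧ ∀ u : Aˣ, aeval (u : A) q = 0 := by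
  classical
  obtain ⟨h1, h2⟩ := hP
  obtain ⟨n, hn⟩ := exists_weights ((P.coeff.support.erase 1).image (fun w i => expSum i w)) (by
    intro e he
    simp only [Finset.mem_image, Finset.mem_erase] at he
    obtain ⟨w, ⟨hw1, hw⟩, rfl⟩ := he
    obtain ⟨i, hi⟩ := h2 w hw hw1
    exact fun h => hi (congrFun h i))
  let φ : FreeGroup (Fin l) → ℤ := fun w => ∑ i, n i * expSum i w
  have hφ : ∀ w ∈ P.coeff.support, φ w = 0 → w = 1 := by
    intro w hw h0
    by_contra hne
    exact hn _ (Finset.mem_image.2 ⟨w, Finset.mem_erase.2 ⟨hne, hw⟩, rfl⟩) h0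
  have hφ1 : φ 1 = 0 := by simp [φ, expSum]
  have hlift : ∀ (u : Aˣ) (w : FreeGroup (Fin l)),
      FreeGroup.lift (fun j => u ^ n j) w = u ^ φ w := by
    intro u w
    let ψ : FreeGroup (Fin l) →* Aˣ :=
      { toFun := fun w => u ^ φ w
        map_one' := by simp [hφ1]
        map_mul' := fun a b => by
          rw [← zpow_add]
          congr 1
          simp [φ, expSum, mul_add, Finset.sum_add_distrib] }
    have : FreeGroup.lift (fun j => u ^ n j) = ψ := by
      ext j
      simp [ψ, φ, expSum]
    rw [this]
    rfl
  let N : ℕ := ∑ w ∈ P.coeff.support, (φ w).natAbs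
  have hN : ∀ w ∈ P.coeff.support, 0 ≤ N + φ w := by
    intro w hw
    have : (φ w).natAbs ≤ N :=
      Finset.single_le_sum (f := fun w => (φ w).natAbs) (fun _ _ => Nat.zero_le _) hw
    omega
  refine ⟨∑ w ∈ P.coeff.support, C (P.coeff w) * X ^ (N + φ w).toNat, ?_, ?_⟩
  · intro h0
    apply h1
    have := congrArg (fun p => p.coeff N) h0
    simp only [finsetSum_coeff, coeff_C_mul, coeff_X_pow, coeff_zero] at this
    rw [← this, Finset.sum_eq_single 1]
    · simp [hφ1]
    · intro w hw hne
      rw [if_neg, mul_zero]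
      intro hEq
      apply hne
      apply hφ w hw
      have := hN w hw
      omega
    · intro h
      rw [Finsupp.notMem_support_iff.1 h, zero_mul]
  · intro u
    have := hLPI (fun j => u ^ n j)
    rw [lpiEval, MonoidAlgebra.lift_apply] at this
    simp only [Finsupp.sum, MonoidHom.comp_apply, hlift, Units.coeHom_apply] at this
    have h3 : (∑ w ∈ P.coeff.support, P.coeff w • ((u ^ φ w : Aˣ) : A)) * ((u ^ N : Aˣ) : A) = 0 := by
      rw [this, zero_mul]
    rw [Finset.sum_mul] at h3
    rw [← h3, map_sum]
    refine Finset.sum_congr rfl fun w hw => ?_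
    rw [map_mul, aeval_C, map_pow, aeval_X, Algebra.smul_def, mul_assoc, ← Units.val_mul,
      ← zpow_natCast u N, ← zpow_add, ← Units.val_pow_eq_pow_val, ← zpow_natCast u,
      Int.toNat_of_nonneg (hN w hw), add_comm]

open Polynomial in
theorem poly_zero_of_eval {R : Type*} [CommRing R] [IsDomain R] [CharZero R]
    {G : Type*} [Group G] (F : (MonoidAlgebra R G)[X])
    (h : ∀ m : ℕ, F.eval (m : MonoidAlgebra R G) = 0) : F = 0 := by
  ext i g
  let F' : R[X] := ∑ i ∈ F.support, C ((F.coeff i).coeff g) * X ^ i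
  have hF' : F' = 0 := by
    refine Polynomial.eq_zero_of_infinite_isRoot _ ?_
    refine (Set.infinite_range_of_injective (Nat.cast_injective (R := R))).mono ?_
    rintro _ ⟨m, rfl⟩
    have h2 := congrArg (fun x => x.coeff g) (h m)
    simp only [eval_eq_sum, Polynomial.sum] at h2
    simp only [Set.mem_ofPred_eq, IsRoot.def, F', eval_finsetSum, eval_mul, eval_C, eval_pow, eval_X]
    rw [MonoidAlgebra.coeff_sum] at h2
    simp only [Finsupp.coe_finsetSum, Finset.sum_apply, MonoidAlgebra.coeff_zero,
      Finsupp.coe_zero, Pi.zero_apply] at h2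
    rw [← h2]
    refine Finset.sum_congr rfl fun j _ => ?_
    rw [← Nat.cast_pow, ← Nat.cast_pow, MonoidAlgebra.natCast_def, MonoidAlgebra.coeff_mul_single_one]
  have := congrArg (fun p => p.coeff i) hF'
  simp only [F', finsetSum_coeff, coeff_C_mul, coeff_X_pow, mul_ite, mul_one, mul_zero,
    Finset.sum_ite_eq, coeff_zero] at this
  by_cases hi : i ∈ F.support
  · simpa [hi] using this
  · simp [notMem_support_iff.1 hi]

open Polynomial in
theorem nilp_of_poly {R : Type*} [CommRing R] [IsDomain R] [CharZero R]
    {G : Type*} [Group G] (q : R[X]) (hq : q ≠ 0)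
    (h : ∀ u : (MonoidAlgebra R G)ˣ, aeval (u : MonoidAlgebra R G) q = 0)
    (a b : MonoidAlgebra R G) (ha : a * a = 0) (hb : b * b = 0) :
    ∃ d : ℕ, (a * b) ^ d = 0 := by
  refine ⟨q.natDegree, ?_⟩
  let U : (MonoidAlgebra R G)[X] := (1 + C a * X) * (1 + C b * X)
  have hdeg : U.natDegree ≤ 2 := by
    simp only [U]
    compute_degree
  have hU2 : U.coeff 2 = a * b := by
    have : U = 1 + C (a + b) * X + C (a * b) * X ^ 2 := by
      simp only [U, C_add, C_mul]
      have : X * C b = C b * (X : (MonoidAlgebra R G)[X]) := X_mul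
      simp only [mul_add, add_mul, mul_one, one_mul, mul_assoc]
      rw [← mul_assoc X (C b), this, pow_two]
      simp only [mul_assoc]
      abel
    rw [this]
    rw [coeff_add, coeff_add, coeff_C_mul_X_pow]
    simp [coeff_one]
  let F : (MonoidAlgebra R G)[X] := ∑ i ∈ Finset.range (q.natDegree + 1), C (algebraMap R _ (q.coeff i)) * U ^ i
  have hF : F = 0 := by
    apply poly_zero_of_eval
    intro m
    let ev : (MonoidAlgebra R G)[X] →+* MonoidAlgebra R G :=
      eval₂RingHom' (RingHom.id _) (m : MonoidAlgebra R G) (fun a => (Nat.cast_commute m _).symm)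
    have hev : ∀ p, p.eval (m : MonoidAlgebra R G) = ev p := fun p => rfl
    have haa : ∀ c : MonoidAlgebra R G, c * c = 0 →
        (1 + c * m) * (1 - c * m) = 1 ∧ (1 - c * m) * (1 + c * m) = 1 := by
      intro c hc
      have : c * m * (c * m) = 0 := by
        rw [mul_assoc, ← mul_assoc (m : MonoidAlgebra R G) c, Nat.cast_comm, mul_assoc, ← mul_assoc, hc, zero_mul]
      constructor <;> simp [mul_add, add_mul, mul_sub, sub_mul, this]
    let u : (MonoidAlgebra R G)ˣ :=
      ⟨1 + a * m, 1 - a * m, (haa a ha).1, (haa a ha).2⟩ * ⟨1 + b * m, 1 - b * m, (haa b hb).1, (haa b hb).2⟩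
    have hu : ev U = u := by
      simp only [U, u, map_mul, map_add, map_one, Units.val_mul]
      simp [ev]
    rw [hev]
    simp only [F, map_sum, map_mul, map_pow, hu]
    rw [← h u, aeval_eq_sum_range]
    refine Finset.sum_congr rfl fun j _ => ?_
    rw [Algebra.smul_def]
    simp [ev]
  have h2 := congrArg (fun p => p.coeff (q.natDegree * 2)) hF
  simp only [F, finsetSum_coeff, coeff_C_mul, coeff_zero] at h2
  rw [Finset.sum_range_succ, coeff_pow_of_natDegree_le hdeg, hU2, Finset.sum_eq_zero, zero_add,
    ← Algebra.smul_def] at h2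
  · ext g
    have := congrArg (fun x => x.coeff g) h2
    simpa [hq] using this
  · intro i hi
    rw [coeff_eq_zero_of_natDegree_lt (p := U ^ i), mul_zero]
    have := natDegree_pow_le_of_le i hdeg
    rw [Finset.mem_range] at hi
    omega

/-- The canonical involution of the integral group ring, as a hom to the opposite ring. -/
noncomputable def zgStar (G : Type*) [Group G] :
    MonoidAlgebra ℤ G →ₐ[ℤ] (MonoidAlgebra ℤ G)ᵐᵒᵖ :=
  MonoidAlgebra.lift ℤ _ G
    { toFun := fun g => MulOpposite.op (MonoidAlgebra.of ℤ G g⁻¹)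
      map_one' := by rw [inv_one, map_one, MulOpposite.op_one]
      map_mul' := fun a b => by rw [mul_inv_rev, map_mul, MulOpposite.op_mul] }

theorem zgStar_single {G : Type*} [Group G] (g : G) (r : ℤ) :
    (zgStar G (MonoidAlgebra.single g r)).unop = MonoidAlgebra.single g⁻¹ r := by
  rw [zgStar, MonoidAlgebra.lift_single]
  simp only [MonoidHom.coe_mk, OneHom.coe_mk, MulOpposite.unop_smul, MulOpposite.unop_op,
    MonoidAlgebra.of_apply, MonoidAlgebra.smul_single, smul_eq_mul, mul_one]

theorem zgStar_coeff {G : Type*} [Group G] (x : MonoidAlgebra ℤ G) (g : G) :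
    (zgStar G x).unop.coeff g = x.coeff g⁻¹ := by
  classical
  induction x using MonoidAlgebra.induction_linear with
  | zero => simp
  | add f g hf hg => simp [hf, hg]
  | single h r =>
    rw [zgStar_single]
    simp [MonoidAlgebra.coeff_single, Finsupp.single_apply, inv_eq_iff_eq_inv]

theorem zgStar_star {G : Type*} [Group G] (x : MonoidAlgebra ℤ G) :
    (zgStar G (zgStar G x).unop).unop = x := by
  ext g
  simp [zgStar_coeff]

theorem zgStar_pos {G : Type*} [Group G] (x : MonoidAlgebra ℤ G)
    (h : x * (zgStar G x).unop = 0) : x = 0 := by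
  have h1 := congrArg (fun y => y.coeff 1) h
  simp only [MonoidAlgebra.coeff_mul_apply_left, zgStar_coeff] at h1
  simp only [mul_one, inv_inv, MonoidAlgebra.coeff_zero, Finsupp.coe_zero, Pi.zero_apply,
    Finsupp.sum] at h1
  rw [Finset.sum_eq_zero_iff_of_nonneg (fun _ _ => mul_self_nonneg _)] at h1
  ext g
  by_cases hg : g ∈ x.coeff.support
  · simpa using h1 g hg
  · simpa using hg

theorem zgStar_nilp {G : Type*} [Group G] (x : MonoidAlgebra ℤ G) (d : ℕ)
    (h : (x * (zgStar G x).unop) ^ d = 0) : x = 0 := by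
  set s := x * (zgStar G x).unop with hs
  have hss : (zgStar G s).unop = s := by
    rw [hs, map_mul, MulOpposite.unop_mul, zgStar_star]
  have key : ∀ k : ℕ, s ^ 2 ^ k = 0 → s = 0 := by
    intro k
    induction k with
    | zero => simp
    | succ k ih =>
      intro hk
      apply ih
      apply zgStar_pos
      rw [map_pow, MulOpposite.unop_pow, hss, ← pow_add, ← two_mul, ← pow_succ']
      exact hk
  apply zgStar_pos
  exact key d (pow_eq_zero_of_le Nat.lt_two_pow_self.le h)

theorem normal_of_nilp {R : Type*} [CommRing R] [CharZero R]
    {G : Type*} [Group G] (hG : ∀ g : G, IsOfFinOrder g)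
    (H : ∀ a b : MonoidAlgebra R G, a * a = 0 → b * b = 0 → ∃ d : ℕ, (a * b) ^ d = 0)
    (g h : G) : ∃ k : ℤ, h⁻¹ * g * h = g ^ k := by
  classical
  let γ := MonoidAlgebra.of ℤ G g
  let η := MonoidAlgebra.of ℤ G h
  let s := ∑ i ∈ Finset.range (orderOf g), γ ^ i
  have hs : s * (1 - γ) = 0 := by
    have := geom_sum_mul γ (orderOf g)
    rw [← map_pow, pow_orderOf_eq_one, map_one, sub_self] at this
    rw [← neg_sub, mul_neg, this, neg_zero]
  let a := (1 - γ) * η * s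
  have ha : a * a = 0 := by
    have : a * a = (1 - γ) * η * (s * (1 - γ)) * (η * s) := by
      simp only [a, mul_assoc]
    rw [this, hs, mul_zero, zero_mul]
  have hb : (zgStar G a).unop * (zgStar G a).unop = 0 := by
    rw [← MulOpposite.unop_mul, ← map_mul, ha, map_zero, MulOpposite.unop_zero]
  let f := MonoidAlgebra.mapRingHom G (Int.castRingHom R)
  have hf : Function.Injective f := by
    intro x y hxy
    ext k
    have := congrArg (fun z => z.coeff k) hxy
    simpa [f] using this
  obtain ⟨d, hd⟩ := H (f a) (f (zgStar G a).unop) (by rw [← map_mul, ha, map_zero])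
    (by rw [← map_mul, hb, map_zero])
  have ha0 : a = 0 := by
    apply zgStar_nilp a d
    apply hf
    rw [map_pow, map_mul, hd, map_zero]
  have hEq : η * s = γ * η * s := by
    have : a = η * s - γ * η * s := by simp only [a, sub_mul, one_mul]
    rw [this, sub_eq_zero] at ha0
    exact ha0
  have h1 := congrArg (fun z => z.coeff h) hEq
  simp only [s, η, γ, Finset.mul_sum, MonoidAlgebra.coeff_sum,
    MonoidAlgebra.of_apply, MonoidAlgebra.single_pow, MonoidAlgebra.single_mul_single, one_pow, mul_one, MonoidAlgebra.coeff_single, Finsupp.coe_finsetSum, Finset.sum_apply,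
    Finsupp.single_apply] at h1
  by_contra hcon
  push Not at hcon
  rw [Finset.sum_eq_zero (f := fun c => if g * h * g ^ c = h then (1 : ℤ) else 0)] at h1
  · have h2 : (1 : ℤ) ≤ ∑ x ∈ Finset.range (orderOf g), if h * g ^ x = h then (1 : ℤ) else 0 := by
      have := Finset.single_le_sum (s := Finset.range (orderOf g))
        (f := fun x => if h * g ^ x = h then (1 : ℤ) else 0)
        (fun i _ => by positivity) (Finset.mem_range.2 (hG g).orderOf_pos)
      simpa using this
    omega
  · intro i _
    rw [if_neg]
    intro hi
    apply hcon (-(i : ℤ))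
    rw [zpow_neg, zpow_natCast, eq_inv_iff_mul_eq_one, mul_assoc, mul_assoc, ← mul_assoc g, hi,
      inv_mul_cancel]

theorem ded_zpow {G : Type*} [Group G] {x y c : G} (h : x * y = c * (y * x))
    (hx : Commute c x) (hy : Commute c y) (n : ℕ) : x * y ^ n = c ^ n * (y ^ n * x) := by
  induction n with
  | zero => simp
  | succ n ih =>
    have h1 : c * y ^ n = y ^ n * c := hy.pow_right n
    calc x * y ^ (n + 1) = x * y ^ n * y := by rw [pow_succ, mul_assoc]
      _ = c ^ n * y ^ n * (x * y) := by rw [ih]; simp only [mul_assoc]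
      _ = c ^ n * (y ^ n * c) * y * x := by rw [h]; simp only [mul_assoc]
      _ = c ^ (n + 1) * (y ^ (n + 1) * x) := by
        rw [← h1, pow_succ c, pow_succ y]; simp only [mul_assoc]

theorem ded_mul_pow {G : Type*} [Group G] {a y c : G} (h : y * a = c * (a * y))
    (hx : Commute c a) (hy : Commute c y) (n : ℕ) :
    (a * y) ^ n = c ^ (n.choose 2) * (a ^ n * y ^ n) := by
  induction n with
  | zero => simp
  | succ n ih =>
    -- move the new factor a past y ^ n
    have h2 : y ^ n * a = c ^ n * (a * y ^ n) := by
      have h' : a * y = c⁻¹ * (y * a) := by rw [h]; group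
      have := ded_zpow h' hx.inv_left hy.inv_left n
      rw [this, inv_pow, mul_inv_cancel_left]
    have h3 : a ^ n * c ^ n = c ^ n * a ^ n := ((hx.pow_left n).pow_right n).symm
    have e : (n + 1).choose 2 = n.choose 2 + n := by
      rw [Nat.choose_succ_succ' n 1, Nat.choose_one_right, add_comm]
    calc (a * y) ^ (n + 1) = c ^ n.choose 2 * a ^ n * (y ^ n * a) * y := by
          rw [pow_succ, ih]; simp only [mul_assoc]
      _ = c ^ n.choose 2 * (a ^ n * c ^ n) * a * y ^ n * y := by rw [h2]; simp only [mul_assoc]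
      _ = c ^ ((n + 1).choose 2) * (a ^ (n + 1) * y ^ (n + 1)) := by
        rw [h3, e, pow_add c, pow_succ a, pow_succ y]; simp only [mul_assoc]

section Ded
variable {G : Type*} [Group G]

theorem ded_comm_mem (hN : ∀ g h : G, ∃ k : ℤ, h⁻¹ * g * h = g ^ k) (x y : G) :
    x * y * x⁻¹ * y⁻¹ ∈ Subgroup.zpowers x ∧ x * y * x⁻¹ * y⁻¹ ∈ Subgroup.zpowers y := by
  constructor
  · obtain ⟨k, hk⟩ := hN x y⁻¹
    refine ⟨1 - k, ?_⟩
    simp only [zpow_sub, ← hk]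
    group
  · obtain ⟨k, hk⟩ := hN y x⁻¹
    refine ⟨k - 1, ?_⟩
    simp only [zpow_sub, ← hk]
    group

theorem ded_main (hN : ∀ g h : G, ∃ k : ℤ, h⁻¹ * g * h = g ^ k) (x y : G)
    (hy : IsOfFinOrder y) (hd : orderOf y ∣ orderOf x) (hxy : ¬ Commute x y) :
    (x * y * x⁻¹ * y⁻¹) ^ 2 = 1 ∧ ∃ (s : ℕ) (u : ℤ), s ∣ orderOf y ∧ Odd (s.choose 2) ∧ Odd u ∧
      y ^ s = x ^ (u * s) ∧ (x ^ (-u) * y) ^ s = x * y * x⁻¹ * y⁻¹ ∧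
      x * (x ^ (-u) * y) * x⁻¹ * (x ^ (-u) * y)⁻¹ = x * y * x⁻¹ * y⁻¹ := by
  set c := x * y * x⁻¹ * y⁻¹ with hc
  have hc1 : c ≠ 1 := by
    intro h
    apply hxy
    rw [hc, mul_inv_eq_one, mul_inv_eq_iff_eq_mul] at h
    exact h
  obtain ⟨hcx, hcy⟩ := ded_comm_mem hN x y
  rw [← hc] at hcx hcy
  have hCx : Commute c x := by
    obtain ⟨k, hk⟩ := hcx
    rw [← hk]
    exact Commute.zpow_self x k
  have hCy : Commute c y := by
    obtain ⟨k, hk⟩ := hcy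
    rw [← hk]
    exact Commute.zpow_self y k
  have hrel : x * y = c * (y * x) := by rw [hc]; group
  have hnorm : (Subgroup.zpowers x).Normal := by
    refine ⟨fun n hn g => ?_⟩
    obtain ⟨j, rfl⟩ := hn
    obtain ⟨k, hk⟩ := hN x g⁻¹
    refine ⟨k * j, ?_⟩
    simp only [zpow_mul, ← hk]
    rw [inv_inv, conj_zpow]
  set s := orderOf (y : G ⧸ Subgroup.zpowers x) with hs
  have hmem : ∀ j : ℤ, y ^ j ∈ Subgroup.zpowers x → (s : ℤ) ∣ j := by
    intro j hj
    rw [orderOf_dvd_iff_zpow_eq_one, ← QuotientGroup.mk_zpow, QuotientGroup.eq_one_iff]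
    exact hj
  have hys : y ^ s ∈ Subgroup.zpowers x := by
    rw [← QuotientGroup.eq_one_iff, QuotientGroup.mk_pow, hs, pow_orderOf_eq_one]
  have hsd : s ∣ orderOf y := by
    rw [orderOf_dvd_iff_pow_eq_one, ← QuotientGroup.mk_pow, pow_orderOf_eq_one,
      QuotientGroup.mk_one]
  obtain ⟨k, hk⟩ := hys
  simp only at hk
  obtain ⟨m, hm⟩ := hsd
  have hypos := hy.orderOf_pos
  have hm0 : m ≠ 0 := by rintro rfl; rw [hm, mul_zero] at hypos; exact absurd hypos (lt_irrefl _)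
  have hsk : (s : ℤ) ∣ k := by
    have h1 : x ^ (k * m) = 1 := by
      rw [zpow_mul, hk, zpow_natCast, ← pow_mul, ← hm, pow_orderOf_eq_one]
    have h2 : (orderOf x : ℤ) ∣ k * m := orderOf_dvd_iff_zpow_eq_one.2 h1
    have h3 : ((s : ℤ) * m) ∣ k * m := by
      refine dvd_trans ?_ h2
      rw [hm] at hd
      exact_mod_cast hd
    exact Int.dvd_of_mul_dvd_mul_right (by exact_mod_cast hm0) h3
  obtain ⟨u, hu⟩ := hsk
  set y1 := x ^ (-u) * y with hy1
  have hcs : c ^ s = 1 := by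
    have h1 := ded_zpow hrel hCx hCy s
    have h2 : x * y ^ s = y ^ s * x := by
      rw [← hk]; exact (Commute.self_zpow x k)
    rw [h2] at h1
    exact (right_eq_mul.1 h1)
  -- commutator of x and y1
  have hc' : x * y1 * x⁻¹ * y1⁻¹ = c := by
    have e1 : x * x ^ (-u) = x ^ (-u) * x := Commute.self_zpow x _
    have e2 : x ^ (-u) * c = c * x ^ (-u) := (hCx.zpow_right _).symm
    calc x * y1 * x⁻¹ * y1⁻¹ = (x * x ^ (-u)) * y * x⁻¹ * y⁻¹ * (x ^ (-u))⁻¹ := by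
          rw [hy1, mul_inv_rev]; simp only [mul_assoc]
      _ = x ^ (-u) * c * (x ^ (-u))⁻¹ := by rw [e1, hc]; simp only [mul_assoc]
      _ = c := by rw [e2, mul_inv_cancel_right]
  have hpow : y1 ^ s = c ^ (u * (s.choose 2 : ℕ)) := by
    have e1 : y * x ^ (-u) = c ^ u * (x ^ (-u) * y) := by
      have e2 : y * x * y⁻¹ = c⁻¹ * x := by rw [hc]; group
      have e3 : y * x ^ (-u) * y⁻¹ = c ^ u * x ^ (-u) := by
        rw [← conj_zpow, e2, hCx.inv_left.mul_zpow, inv_zpow, zpow_neg c, inv_inv]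
      rw [← mul_assoc, ← e3, inv_mul_cancel_right]
    have := ded_mul_pow e1 ((hCx.zpow_right _).zpow_left _) (hCy.zpow_left _) s
    rw [hy1, this, ← zpow_natCast (x ^ (-u)), ← zpow_mul, ← hk, ← zpow_add, hu, zpow_mul c,
      zpow_natCast]
    have : -u * (s : ℤ) + s * u = 0 := by ring
    rw [this, zpow_zero, mul_one]
  have hcy1 : ∃ i : ℤ, c = (y1 ^ s) ^ i := by
    obtain ⟨j, hj⟩ := (ded_comm_mem hN x y1).2
    rw [hc'] at hj
    simp only at hj
    have hq : ((y1 : G) : G ⧸ Subgroup.zpowers x) = y := by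
      rw [hy1, QuotientGroup.mk_mul, (QuotientGroup.eq_one_iff _).2
        (Subgroup.zpow_mem_zpowers x (-u)), one_mul]
    have : (s : ℤ) ∣ j := by
      rw [hs, ← hq, orderOf_dvd_iff_zpow_eq_one, ← QuotientGroup.mk_zpow,
        QuotientGroup.eq_one_iff, hj]
      exact hcx
    obtain ⟨i, hi⟩ := this
    refine ⟨i, ?_⟩
    rw [← hj, hi, zpow_mul, zpow_natCast]
  obtain ⟨i, hi⟩ := hcy1
  have h2c : ((s.choose 2 : ℕ) : ℤ) * 2 = s * (s - 1 : ℤ) := by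
    rcases Nat.eq_zero_or_pos s with h0 | h0
    · simp [h0]
    · obtain ⟨r, hr⟩ : ∃ r, s = r + 1 := ⟨s - 1, by omega⟩
      rw [hr]
      have := Nat.choose_two_right (r + 1)
      have h4 : 2 ∣ (r + 1) * (r + 1 - 1) := by
        rw [Nat.add_sub_cancel, mul_comm]; exact (Nat.even_mul_succ_self r).two_dvd
      have h5 : (r + 1).choose 2 * 2 = (r + 1) * r := by
        rw [this, Nat.div_mul_cancel h4, Nat.add_sub_cancel]
      push_cast
      have : (((r + 1).choose 2 * 2 : ℕ) : ℤ) = (((r + 1) * r : ℕ) : ℤ) := by rw [h5]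
      push_cast at this
      linarith
  have hcc : c ^ 2 = 1 := by
    have e1 : (y1 ^ s) ^ 2 = 1 := by
      rw [hpow, ← zpow_natCast, ← zpow_mul, mul_assoc]
      push_cast
      rw [h2c]
      have : u * ((s : ℤ) * (s - 1)) = s * (u * (s - 1)) := by ring
      rw [this, zpow_mul, zpow_natCast, hcs, one_zpow]
    rw [hi, ← zpow_natCast, ← zpow_mul, mul_comm, zpow_mul, zpow_natCast, e1, one_zpow]
  have hodd : Odd (u * ((s.choose 2 : ℕ) : ℤ)) := by
    by_contra hcon
    rw [Int.not_odd_iff_even] at hcon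
    obtain ⟨r, hr⟩ := hcon.two_dvd
    apply hc1
    rw [hi, hpow, hr, zpow_mul, ← Nat.cast_two, zpow_natCast, hcc, one_zpow, one_zpow]
  refine ⟨hcc, s, u, ⟨m, hm⟩, ?_, (Int.odd_mul.1 hodd).1, ?_, ?_, hc'⟩
  · exact_mod_cast (Int.odd_mul.1 hodd).2
  · rw [← hk, hu, mul_comm]
  · rw [hpow]
    obtain ⟨r, hr⟩ := hodd
    rw [hr, zpow_add, zpow_mul, ← Nat.cast_two, zpow_natCast, hcc, one_zpow, one_mul, zpow_one]

theorem ded_comm_ne {x y : G} (h : ¬ Commute x y) : x * y * x⁻¹ * y⁻¹ ≠ 1 := by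
  intro h'
  apply h
  rw [mul_inv_eq_one, mul_inv_eq_iff_eq_mul] at h'
  exact h'

theorem ded_two_aux (hN : ∀ g h : G, ∃ k : ℤ, h⁻¹ * g * h = g ^ k) (x y : G)
    (a b : ℕ) (ha : orderOf x = 2 ^ a) (hb : orderOf y = 2 ^ b)
    (hd : orderOf y ∣ orderOf x) (hxy : ¬ Commute x y) :
    ∃ u : ℤ, Odd u ∧ y ^ 2 = x ^ (u * 2) ∧ (x ^ (-u) * y) ^ 2 = x * y * x⁻¹ * y⁻¹ ∧
      x * (x ^ (-u) * y) * x⁻¹ * (x ^ (-u) * y)⁻¹ = x * y * x⁻¹ * y⁻¹ := by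
  have hy : IsOfFinOrder y := by
    rw [← orderOf_pos_iff, hb]; positivity
  obtain ⟨-, s, u, hs, hodd, hu, h1, h2, h3⟩ := ded_main hN x y hy hd hxy
  have : s = 2 := by
    rw [hb, Nat.dvd_prime_pow Nat.prime_two] at hs
    obtain ⟨r, -, rfl⟩ := hs
    match r with
    | 0 => simp at hodd
    | 1 => rfl
    | r + 2 =>
      exfalso
      rw [Nat.choose_two_right] at hodd
      have : 2 ^ (r + 2) * (2 ^ (r + 2) - 1) / 2 = 2 * (2 ^ r * (2 ^ (r + 2) - 1)) := by
        apply Nat.div_eq_of_eq_mul_right (by norm_num)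
        rw [pow_add]; ring
      rw [this] at hodd
      exact (Nat.not_odd_iff_even.2 (even_two_mul _)) hodd
  subst this
  exact ⟨u, hu, by exact_mod_cast h1, h2, h3⟩

theorem ded_two_half {x y : G} (hN : ∀ g h : G, ∃ k : ℤ, h⁻¹ * g * h = g ^ k)
    (h4 : x ^ 4 = 1) (hxy : ¬ Commute x y) :
    x * y * x⁻¹ * y⁻¹ = x ^ 2 := by
  obtain ⟨⟨k, hk⟩, hcy⟩ := ded_comm_mem hN x y
  simp only at hk
  have h4' : x ^ (4 : ℤ) = 1 := by exact_mod_cast h4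
  have hk4 : x ^ k = x ^ (k % 4) := by
    conv_lhs => rw [← Int.emod_add_mul_ediv k 4, zpow_add, zpow_mul, h4', one_zpow, mul_one]
  have hCy : Commute (x ^ k) y := by
    rw [hk]
    obtain ⟨j, hj⟩ := hcy
    rw [← hj]
    exact Commute.zpow_self y j
  have : k % 4 = 0 ∨ k % 4 = 1 ∨ k % 4 = 2 ∨ k % 4 = 3 := by omega
  rcases this with h | h | h | h <;> rw [h] at hk4
  · exact absurd (by rw [← hk, hk4, zpow_zero]) (ded_comm_ne hxy)
  · rw [hk4, zpow_one] at hCy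
    exact absurd hCy hxy
  · rw [← hk, hk4]; exact_mod_cast zpow_natCast x 2
  · rw [hk4] at hCy
    have : x = (x ^ (3 : ℤ))⁻¹ := by
      rw [eq_inv_iff_mul_eq_one, ← zpow_one_add]
      exact h4'
    rw [this] at hxy
    exact absurd hCy.inv_left hxy

theorem ded_two_le (hN : ∀ g h : G, ∃ k : ℤ, h⁻¹ * g * h = g ^ k) (x y : G)
    (a b : ℕ) (ha : orderOf x = 2 ^ a) (hb : orderOf y = 2 ^ b)
    (hd : orderOf y ∣ orderOf x) (hxy : ¬ Commute x y) : x ^ 4 = 1 ∧ y ^ 4 = 1 := by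
  have hx4 : x ^ 4 = 1 := by
    rw [← orderOf_dvd_iff_pow_eq_one]
    by_cases ha2 : a ≤ 2
    · rw [ha]
      exact pow_dvd_pow 2 ha2
    obtain ⟨u, hu, h1, h2, h3⟩ := ded_two_aux hN x y a b ha hb hd hxy
    have hcc : (x * y * x⁻¹ * y⁻¹) ^ 2 = 1 :=
      (ded_main hN x y (by rw [← orderOf_pos_iff, hb]; positivity) hd hxy).1
    set y1 := x ^ (-u) * y
    have hy4 : y1 ^ 4 = 1 := by
      rw [show 4 = 2 * 2 from rfl, pow_mul, h2, hcc]
    have hy1 : orderOf y1 = 2 ^ 2 := by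
      apply orderOf_eq_prime_pow
      · rw [pow_one, h2]
        exact ded_comm_ne hxy
      · exact hy4
    have hxy1 : ¬ Commute x y1 := by
      intro h
      apply ded_comm_ne hxy
      rw [← h3, h.eq, mul_inv_cancel_right, mul_inv_cancel]
    obtain ⟨v, hv, h5, -, -⟩ := ded_two_aux hN x y1 a 2 ha hy1
      (by rw [ha, hy1]; exact pow_dvd_pow 2 (by omega)) hxy1
    have h6 : x ^ (v * 4) = 1 := by
      have : v * 4 = v * 2 * (2 : ℕ) := by push_cast; ring
      rw [this, zpow_mul, ← h5, zpow_natCast, ← pow_mul]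
      exact hy4
    have h7 : (orderOf x : ℤ) ∣ v * 4 := orderOf_dvd_iff_zpow_eq_one.2 h6
    have h8 : IsCoprime (orderOf x : ℤ) v := by
      rw [ha]
      push_cast
      apply IsCoprime.pow_left
      obtain ⟨w, hw⟩ := hv
      exact ⟨-w, 1, by rw [hw]; ring⟩
    exact_mod_cast h8.dvd_of_dvd_mul_left h7
  refine ⟨hx4, ?_⟩
  rw [← orderOf_dvd_iff_pow_eq_one] at hx4 ⊢
  exact hd.trans hx4

theorem ded_two (hN : ∀ g h : G, ∃ k : ℤ, h⁻¹ * g * h = g ^ k) (x y : G)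
    (a b : ℕ) (ha : x ^ 2 ^ a = 1) (hb : y ^ 2 ^ b = 1) (hxy : ¬ Commute x y) :
    x ^ 4 = 1 ∧ y ^ 4 = 1 := by
  obtain ⟨a', -, ha'⟩ := (Nat.dvd_prime_pow Nat.prime_two).1 (orderOf_dvd_of_pow_eq_one ha)
  obtain ⟨b', -, hb'⟩ := (Nat.dvd_prime_pow Nat.prime_two).1 (orderOf_dvd_of_pow_eq_one hb)
  rcases le_total b' a' with h | h
  · exact ded_two_le hN x y a' b' ha' hb' (by rw [ha', hb']; exact pow_dvd_pow 2 h) hxy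
  · exact (ded_two_le hN y x b' a' hb' ha' (by rw [ha', hb']; exact pow_dvd_pow 2 h)
      (fun h => hxy h.symm)).symm

theorem ded_primary (y : G) (n : ℕ) : n ≠ 0 → ∀ x : G, x ^ n = 1 → ¬ Commute x y →
    ∃ (p k : ℕ) (a : ℕ), p.Prime ∧ (x ^ a) ^ p ^ k = 1 ∧ ¬ Commute (x ^ a) y := by
  induction n using Nat.recOnPosPrimePosCoprime with
  | prime_pow p n hp hn => exact fun _ x hx hxy => ⟨p, n, 1, hp, by simpa using hx, by simpa using hxy⟩
  | zero => intro h; exact absurd rfl h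
  | one => intro _ x hx hxy; rw [pow_one] at hx; subst hx; exact absurd (Commute.one_left y) hxy
  | coprime m n hm hn hmn ihm ihn =>
    intro _ x hx hxy
    by_cases h1 : Commute (x ^ m) y
    · by_cases h2 : Commute (x ^ n) y
      · exfalso
        apply hxy
        have := Nat.gcd_eq_gcd_ab m n
        rw [hmn.gcd_eq_one] at this
        have e : x = (x ^ m) ^ (Nat.gcdA m n) * (x ^ n) ^ (Nat.gcdB m n) := by
          rw [← zpow_natCast, ← zpow_natCast, ← zpow_mul, ← zpow_mul, ← zpow_add, ← this]
          simp
        rw [e]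
        exact (h1.zpow_left _).mul_left (h2.zpow_left _)
      · obtain ⟨p, k, a, hp, h3, h4⟩ := ihm (by omega) (x ^ n) (by rw [← pow_mul, mul_comm]; exact hx) h2
        exact ⟨p, k, n * a, hp, by rwa [pow_mul], by rwa [pow_mul]⟩
    · obtain ⟨p, k, a, hp, h3, h4⟩ := ihn (by omega) (x ^ m) (by rw [← pow_mul]; exact hx) h1
      exact ⟨p, k, m * a, hp, by rwa [pow_mul], by rwa [pow_mul]⟩

theorem ded_primary_two (hN : ∀ g h : G, ∃ k : ℤ, h⁻¹ * g * h = g ^ k)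
    (hG : ∀ g : G, IsOfFinOrder g) (x y : G) (hxy : ¬ Commute x y) :
    ∃ a b i j : ℕ, (x ^ a) ^ 2 ^ i = 1 ∧ (y ^ b) ^ 2 ^ j = 1 ∧ ¬ Commute (x ^ a) (y ^ b) := by
  obtain ⟨p, i, a, hp, h1, h2⟩ := ded_primary y (orderOf x) (hG x).orderOf_pos.ne' x
    (pow_orderOf_eq_one x) hxy
  obtain ⟨q, j, b, hq, h3, h4⟩ := ded_primary (x ^ a) (orderOf y) (hG y).orderOf_pos.ne' y
    (pow_orderOf_eq_one y) (fun h => h2 h.symm)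
  set X := x ^ a
  set Y := y ^ b
  have hXY : ¬ Commute X Y := fun h => h4 h.symm
  have hpow : ∀ (z c : G) (n : ℕ), z ^ n = 1 → c ∈ Subgroup.zpowers z → c ^ n = 1 := by
    rintro z _ n hz ⟨k, rfl⟩
    simp only
    rw [← zpow_natCast, ← zpow_mul, mul_comm, zpow_mul, zpow_natCast, hz, one_zpow]
  obtain ⟨hcX, hcY⟩ := ded_comm_mem hN X Y
  have hc1 := hpow _ _ _ h1 hcX
  have hc2 := hpow _ _ _ h3 hcY
  have hc := ded_comm_ne hXY
  have hcop : ∀ m n : ℕ, (X * Y * X⁻¹ * Y⁻¹) ^ m = 1 → (X * Y * X⁻¹ * Y⁻¹) ^ n = 1 →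
      ¬ m.Coprime n := by
    intro m n hm hn hmn
    apply hc
    rw [← orderOf_eq_one_iff]
    exact Nat.eq_one_of_dvd_coprimes hmn (orderOf_dvd_of_pow_eq_one hm) (orderOf_dvd_of_pow_eq_one hn)
  have hpq : p = q := by
    by_contra hne
    exact hcop _ _ hc1 hc2 (Nat.Coprime.pow _ _ ((Nat.coprime_primes hp hq).2 hne))
  subst hpq
  have hcc : (X * Y * X⁻¹ * Y⁻¹) ^ 2 = 1 := by
    obtain ⟨i', -, hi'⟩ := (Nat.dvd_prime_pow hp).1 (orderOf_dvd_of_pow_eq_one h1)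
    obtain ⟨j', -, hj'⟩ := (Nat.dvd_prime_pow hp).1 (orderOf_dvd_of_pow_eq_one h3)
    rcases le_total j' i' with h | h
    · exact (ded_main hN X Y (hG _) (by rw [hi', hj']; exact pow_dvd_pow p h) hXY).1
    · have := (ded_main hN Y X (hG _) (by rw [hi', hj']; exact pow_dvd_pow p h) h4).1
      have e : X * Y * X⁻¹ * Y⁻¹ = (Y * X * Y⁻¹ * X⁻¹)⁻¹ := by group
      rw [e, inv_pow, this, inv_one]
  have hp2 : p = 2 := by
    by_contra hne
    exact hcop _ _ hc1 hcc (Nat.Coprime.pow_left _ ((Nat.coprime_primes hp Nat.prime_two).2 hne))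
  subst hp2
  exact ⟨a, b, i, j, h1, h3, hXY⟩

theorem ded_odd_central (hN : ∀ g h : G, ∃ k : ℤ, h⁻¹ * g * h = g ^ k)
    (hG : ∀ g : G, IsOfFinOrder g) (x y : G) (n : ℕ) (hn : Odd n) (hx : x ^ n = 1) :
    Commute x y := by
  by_contra hxy
  obtain ⟨a, b, i, j, h1, -, h3⟩ := ded_primary_two hN hG x y hxy
  apply h3
  have h4 : (x ^ a) ^ n = 1 := by rw [← pow_mul, mul_comm, pow_mul, hx, one_pow]
  have : x ^ a = 1 := by
    rw [← orderOf_eq_one_iff]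
    exact Nat.eq_one_of_dvd_coprimes (Nat.Coprime.pow_left i (Nat.coprime_two_left.2 hn))
      (orderOf_dvd_of_pow_eq_one h1) (orderOf_dvd_of_pow_eq_one h4)
  rw [this]
  exact Commute.one_left _

theorem ded_centralizer (hN : ∀ g h : G, ∃ k : ℤ, h⁻¹ * g * h = g ^ k)
    (hG : ∀ g : G, IsOfFinOrder g) (x y : G) (i j : ℕ) (hx : x ^ 2 ^ i = 1) (hy : y ^ 2 ^ j = 1)
    (hxy : ¬ Commute x y) (t : G) (htx : Commute t x) (hty : Commute t y) (h : G) :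
    Commute t h := by
  obtain ⟨a, m, hm, hn⟩ := Nat.exists_eq_two_pow_mul_odd (hG t).orderOf_pos.ne'
  have ht : t ^ (2 ^ a * m) = 1 := by rw [← hn, pow_orderOf_eq_one]
  have hcop : Nat.Coprime (2 ^ a) m := Nat.Coprime.pow_left a (Nat.coprime_two_left.2 hm)
  have hb := Nat.gcd_eq_gcd_ab (2 ^ a) m
  rw [hcop.gcd_eq_one] at hb
  have e : t = (t ^ 2 ^ a) ^ (Nat.gcdA (2 ^ a) m) * (t ^ m) ^ (Nat.gcdB (2 ^ a) m) := by
    rw [← zpow_natCast, ← zpow_natCast, ← zpow_mul, ← zpow_mul, ← zpow_add, ← hb]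
    simp
  have h1 : Commute (t ^ 2 ^ a) h :=
    ded_odd_central hN hG _ _ m hm (by rw [← pow_mul, ht])
  have h2 : Commute (t ^ m) h := by
    set w := t ^ m
    have hw : w ^ 2 ^ a = 1 := by rw [← pow_mul, mul_comm, ht]
    have hwx : Commute w x := htx.pow_left m
    have hwy : Commute w y := hty.pow_left m
    have hxwy : ¬ Commute (x * w) y := by
      intro hc
      apply hxy
      have := hc.mul_left hwy.inv_left
      rwa [mul_inv_cancel_right] at this
    have hxw : (x * w) ^ 2 ^ (i + a) = 1 := by
      rw [hwx.symm.mul_pow, pow_add, pow_mul, hx, one_pow, mul_comm, pow_mul, hw, one_pow, one_mul]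
    have h3 := ded_two_half hN (ded_two hN x y i j hx hy hxy).1 hxy
    have h4 := ded_two_half hN (ded_two hN (x * w) y (i + a) j hxw hy hxwy).1 hxwy
    have h5 : x * w * y * (x * w)⁻¹ * y⁻¹ = x * y * x⁻¹ * y⁻¹ := by
      rw [mul_assoc x w y, hwy.eq, mul_inv_rev]
      group
    have h6 : w ^ 2 = 1 := by
      rw [h5, h3, hwx.symm.mul_pow] at h4
      exact left_eq_mul.1 h4
    obtain ⟨k, hk⟩ := hN w h
    have h6' : w ^ (2 : ℤ) = 1 := by exact_mod_cast h6
    rcases Int.even_or_odd' k with ⟨r, hr | hr⟩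
    · rw [hr, zpow_mul, h6', one_zpow, mul_eq_one_iff_eq_inv, mul_eq_left] at hk
      rw [hk]
      exact Commute.one_left h
    · rw [hr, zpow_add, zpow_mul, h6', one_zpow, one_mul, zpow_one, mul_assoc,
        inv_mul_eq_iff_eq_mul] at hk
      exact hk
  rw [e]
  exact (h1.zpow_left _).mul_left (h2.zpow_left _)

theorem ded_conj (hN : ∀ g h : G, ∃ k : ℤ, h⁻¹ * g * h = g ^ k) (x g : G) (h4 : x ^ 4 = 1)
    : g * x = x * g ∨ g * x = x⁻¹ * g := by
  by_cases hc : Commute x g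
  · exact Or.inl hc.eq.symm
  · right
    have h := ded_two_half hN h4 hc
    have e2 : g * x⁻¹ * g⁻¹ = x := by
      have e : x⁻¹ * (x * g * x⁻¹ * g⁻¹) = x⁻¹ * x ^ 2 := by rw [h]
      rw [pow_two, inv_mul_cancel_left] at e
      simpa only [mul_assoc, inv_mul_cancel_left] using e
    rw [mul_inv_eq_iff_eq_mul] at e2
    have : SemiconjBy g x⁻¹ x := e2
    simpa using this.inv_right.eq

theorem ded_final (hN : ∀ g h : G, ∃ k : ℤ, h⁻¹ * g * h = g ^ k)
    (hG : ∀ g : G, IsOfFinOrder g) : ∃ x y : G, ∀ g : G, ∃ t ∈ Subgroup.center G,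
      g = t ∨ g = t * x ∨ g = t * y ∨ g = t * (x * y) := by
  by_cases hab : ∀ x y : G, Commute x y
  · exact ⟨1, 1, fun g => ⟨g, Subgroup.mem_center_iff.2 fun h => hab h g, Or.inl rfl⟩⟩
  push Not at hab
  obtain ⟨x0, y0, h0⟩ := hab
  obtain ⟨a, b, i, j, hx, hy, hxy⟩ := ded_primary_two hN hG x0 y0 h0
  generalize x0 ^ a = x at *
  generalize y0 ^ b = y at *
  have hcent : ∀ t : G, t * x = x * t → t * y = y * t → t ∈ Subgroup.center G := by
    intro t h1 h2
    rw [Subgroup.mem_center_iff]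
    intro h
    exact (ded_centralizer hN hG x y i j hx hy hxy t h1 h2 h).eq.symm
  obtain ⟨hx4, hy4⟩ := ded_two hN x y i j hx hy hxy
  have hyx : ¬ Commute y x := fun h => hxy h.symm
  have hyx' : y * x = x⁻¹ * y := (ded_conj hN x y hx4).resolve_left hyx
  have hxy' : x * y = y⁻¹ * x := (ded_conj hN y x hy4).resolve_left hxy
  have Hy : SemiconjBy y⁻¹ x x⁻¹ := by
    have : SemiconjBy y x x⁻¹ := hyx'
    simpa using this.inv_symm_left.inv_right
  have Hx : SemiconjBy x⁻¹ y y⁻¹ := by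
    have : SemiconjBy x y y⁻¹ := hxy'
    simpa using this.inv_symm_left.inv_right
  have hinv : ∀ g z : G, SemiconjBy g z z⁻¹ → SemiconjBy g z⁻¹ z := by
    intro g z h
    simpa using h.inv_right
  have hself : ∀ z : G, SemiconjBy z⁻¹ z z := fun z => (Commute.refl z).inv_left
  have hself' : ∀ z : G, SemiconjBy z⁻¹ z⁻¹ z⁻¹ := fun z => Commute.refl z⁻¹
  refine ⟨x, y, fun g => ?_⟩
  rcases ded_conj hN x g hx4 with gx | gx <;> rcases ded_conj hN y g hy4 with gy | gy
  · exact ⟨g, hcent g gx gy, Or.inl rfl⟩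
  · refine ⟨g * x⁻¹, hcent _ ?_ ?_, Or.inr (Or.inl (by simp))⟩
    · exact SemiconjBy.mul_left gx (hself x)
    · exact SemiconjBy.mul_left (hinv g y gy) Hx
  · refine ⟨g * y⁻¹, hcent _ ?_ ?_, Or.inr (Or.inr (Or.inl (by simp)))⟩
    · exact SemiconjBy.mul_left (hinv g x gx) Hy
    · exact SemiconjBy.mul_left gy (hself y)
  · refine ⟨g * (y⁻¹ * x⁻¹), hcent _ ?_ ?_, Or.inr (Or.inr (Or.inr (by group)))⟩
    · exact SemiconjBy.mul_left (hinv g x gx) (Hy.mul_left (hself x))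
    · exact SemiconjBy.mul_left (hinv g y gy) ((hself' y).mul_left Hx)
end Ded

/-- Let `G` be a torsion group and `R` a commutative domain of
characteristic `0`. If the unit group of the group algebra `RG` satisfies a Laurent
polynomial identity `P` as above, then `RG` satisfies the standard identity `S₄`. -/
theorem stmt6 {R : Type*} [CommRing R] [IsDomain R] [CharZero R]
    {G : Type*} [Group G] (hG : ∀ g : G, IsOfFinOrder g)
    {l : ℕ} (P : MonoidAlgebra R (FreeGroup (Fin l)))
    (hP : GoodLPI P) (hLPI : SatisfiesLPI (MonoidAlgebra R G) P) :
    ∀ y : Fin 4 → MonoidAlgebra R G,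
      ∑ σ : Equiv.Perm (Fin 4),
        (Equiv.Perm.sign σ : ℤ) • (y (σ 0) * y (σ 1) * y (σ 2) * y (σ 3)) = 0 := by
  obtain ⟨q, hq, hu⟩ := exists_poly P hP hLPI
  obtain ⟨x, y, hxy⟩ := ded_final (normal_of_nilp hG (nilp_of_poly q hq hu)) hG
  exact s4_group x y hxy
end
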